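/- Let p > 2 and set ℓ* = π/√(p−2). If ℓ > ℓ*, then there exist exactly two points z in (0, (p/2)^(1/(p−2))) \ {1} with L₁(z) = ℓ, namely a unique z₁ ∈ (0,1) and a unique z₂ ∈ (1, (p/2)^(1/(p−2))); if 0 < ℓ ≤ ℓ*, then there is no z in (0, (p/2)^(1/(p−2))) \ {1} with L₁(z) = ℓ. -/

import Mathlib

open MeasureTheory

/-- `f(t) = t²/2 - tᵖ/p`. -/
noncomputable def f (p t : ℝ) : ℝ := t ^ 2 / 2 - t ^ p / p

open Set Filter Topology

/-- The potential well `V = f(1) - f`, which vanishes at its minimum `t = 1`. -/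
noncomputable def potential (p t : ℝ) : ℝ := f p 1 - f p t

/-- First derivative of `potential p` on `(0, ∞)`. -/
noncomputable def potentialDeriv (p t : ℝ) : ℝ := t * t ^ (p - 2) - t

/-- Second derivative of `potential p` on `(0, ∞)`. -/
noncomputable def potentialDeriv₂ (p t : ℝ) : ℝ := (p - 1) * t ^ (p - 2) - 1

/-- Third derivative of `potential p` on `(0, ∞)`. -/
noncomputable def potentialDeriv₃ (p t : ℝ) : ℝ := (p - 1) * (p - 2) * t ^ (p - 2) / t

/-- The right end `(p / 2) ^ (1 / (p - 2))` of the well, the positive zero of `f p`. -/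
noncomputable def wellEnd (p : ℝ) : ℝ := (p / 2) ^ (1 / (p - 2))

section Potential

variable {p t : ℝ}

lemma f_one (p : ℝ) : f p 1 = 1 / 2 - 1 / p := by simp [f]

lemma f_one_pos (hp : 2 < p) : 0 < f p 1 := by
  rw [f_one, sub_pos]
  exact one_div_lt_one_div_of_lt two_pos hp

lemma potential_one (p : ℝ) : potential p 1 = 0 := sub_self _

lemma potentialDeriv_one (p : ℝ) : potentialDeriv p 1 = 0 := by simp [potentialDeriv]

lemma potentialDeriv₂_one (p : ℝ) : potentialDeriv₂ p 1 = p - 2 := by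
  simp [potentialDeriv₂]; ring

lemma potential_zero (hp : 2 < p) : potential p 0 = f p 1 := by
  simp [potential, f, Real.zero_rpow (by linarith : p ≠ 0)]

lemma one_lt_wellEnd (hp : 2 < p) : 1 < wellEnd p :=
  Real.one_lt_rpow (by linarith) (one_div_pos.2 (by linarith))

lemma potential_wellEnd (hp : 2 < p) : potential p (wellEnd p) = f p 1 := by
  have hB : 0 < wellEnd p := zero_lt_one.trans (one_lt_wellEnd hp)
  have h1 : wellEnd p ^ (p - 2) = p / 2 := by
    rw [wellEnd, ← Real.rpow_mul (by linarith), one_div_mul_cancel (by linarith), Real.rpow_one]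
  have h2 : wellEnd p ^ p = wellEnd p ^ (p - 2) * wellEnd p ^ 2 := by
    rw [← Real.rpow_natCast, ← Real.rpow_add hB]; norm_num
  have : f p (wellEnd p) = 0 := by
    rw [f, h2, h1]; field_simp; ring
  rw [potential, this, sub_zero]

lemma continuous_potential (hp : 2 < p) : Continuous (potential p) := by
  have : Continuous fun t : ℝ => t ^ p := Real.continuous_rpow_const (by linarith)
  unfold potential f
  fun_prop

lemma hasDerivAt_rpow_sub_two (ht : 0 < t) :
    HasDerivAt (fun t : ℝ => t ^ (p - 2)) ((p - 2) * t ^ (p - 2) / t) t := by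
  have := Real.hasDerivAt_rpow_const (p := p - 2) (Or.inl ht.ne')
  rwa [Real.rpow_sub_one ht.ne', ← mul_div_assoc] at this

lemma hasDerivAt_potential (hp : 2 < p) (ht : 0 < t) :
    HasDerivAt (potential p) (potentialDeriv p t) t := by
  have h1 := Real.hasDerivAt_rpow_const (p := p) (Or.inl ht.ne')
  have h2 := (((hasDerivAt_pow 2 t).div_const 2).sub (h1.div_const p)).const_sub (f p 1)
  have h3 : t ^ (p - 1) = t * t ^ (p - 2) := by
    rw [show p - 1 = (p - 2) + 1 by ring, Real.rpow_add_one ht.ne', mul_comm]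
  refine h2.congr_deriv ?_
  rw [h3, potentialDeriv]
  field_simp
  ring

lemma hasDerivAt_potentialDeriv (ht : 0 < t) :
    HasDerivAt (potentialDeriv p) (potentialDeriv₂ p t) t := by
  refine (((hasDerivAt_id t).mul (hasDerivAt_rpow_sub_two (p := p) ht)).sub
    (hasDerivAt_id t)).congr_deriv ?_
  simp only [id, potentialDeriv₂]
  field_simp
  ring

lemma hasDerivAt_potentialDeriv₂ (ht : 0 < t) :
    HasDerivAt (potentialDeriv₂ p) (potentialDeriv₃ p t) t := by
  refine (((hasDerivAt_rpow_sub_two (p := p) ht).const_mul (p - 1)).sub_const 1).congr_deriv ?_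
  simp only [potentialDeriv₃]
  ring

lemma hasDerivAt_potentialDeriv₃ (ht : 0 < t) :
    HasDerivAt (potentialDeriv₃ p) ((p - 1) * (p - 2) * (p - 3) * t ^ (p - 2) / t ^ 2) t := by
  refine (((hasDerivAt_rpow_sub_two (p := p) ht).const_mul ((p - 1) * (p - 2))).div
    (hasDerivAt_id t) ht.ne').congr_deriv ?_
  simp only [id]
  field_simp
  ring

lemma potentialDeriv_pos (hp : 2 < p) (ht : 1 < t) : 0 < potentialDeriv p t := by
  have h : 1 < t ^ (p - 2) := Real.one_lt_rpow ht (by linarith)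
  unfold potentialDeriv
  nlinarith

lemma potentialDeriv_neg (hp : 2 < p) (ht0 : 0 < t) (ht : t < 1) : potentialDeriv p t < 0 := by
  have h : t ^ (p - 2) < 1 := Real.rpow_lt_one ht0.le ht (by linarith)
  unfold potentialDeriv
  nlinarith

lemma potentialDeriv_ne_zero (hp : 2 < p) (ht0 : 0 < t) (ht : t ≠ 1) : potentialDeriv p t ≠ 0 :=
  ht.lt_or_gt.elim (fun h => (potentialDeriv_neg hp ht0 h).ne)
    fun h => (potentialDeriv_pos hp h).ne'

lemma strictAntiOn_potential (hp : 2 < p) : StrictAntiOn (potential p) (Icc 0 1) := by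
  refine strictAntiOn_of_deriv_neg (convex_Icc 0 1) (continuous_potential hp).continuousOn ?_
  rw [interior_Icc]
  intro t ht
  rw [(hasDerivAt_potential hp ht.1).deriv]
  exact potentialDeriv_neg hp ht.1 ht.2

lemma strictMonoOn_potential (hp : 2 < p) : StrictMonoOn (potential p) (Ici 1) := by
  refine strictMonoOn_of_deriv_pos (convex_Ici 1) (continuous_potential hp).continuousOn ?_
  rw [interior_Ici]
  intro t ht
  rw [(hasDerivAt_potential hp (zero_lt_one.trans ht)).deriv]
  exact potentialDeriv_pos hp ht

lemma potential_pos (hp : 2 < p) (ht0 : 0 ≤ t) (ht : t ≠ 1) : 0 < potential p t := by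
  rw [← potential_one p]
  rcases ht.lt_or_gt with h | h
  · exact strictAntiOn_potential hp ⟨ht0, h.le⟩ ⟨zero_le_one, le_rfl⟩ h
  · exact strictMonoOn_potential hp self_mem_Ici h.le h

lemma potential_nonneg (hp : 2 < p) (ht0 : 0 ≤ t) : 0 ≤ potential p t := by
  rcases eq_or_ne t 1 with rfl | h
  · exact (potential_one p).ge
  · exact (potential_pos hp ht0 h).le

lemma potentialDeriv₂_strictMonoOn (hp : 2 < p) : StrictMonoOn (potentialDeriv₂ p) (Ioi 0) := by
  intro s hs t _ hst
  have := Real.rpow_lt_rpow (le_of_lt hs) hst (by linarith : 0 < p - 2)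
  unfold potentialDeriv₂
  nlinarith

lemma six_mul_sq_sub_pos (hp : 2 < p) (ht : 0 < t) :
    0 < 6 * potentialDeriv₂ p t ^ 2 - 2 * potentialDeriv p t * potentialDeriv₃ p t := by
  have hy : 0 < t ^ (p - 2) := Real.rpow_pos_of_pos ht _
  have key : 6 * potentialDeriv₂ p t ^ 2 - 2 * potentialDeriv p t * potentialDeriv₃ p t
      = 6 * ((p - 1) * t ^ (p - 2) - 1) ^ 2
        - 2 * ((p - 1) * (p - 2)) * t ^ (p - 2) * (t ^ (p - 2) - 1) := by
    unfold potentialDeriv potentialDeriv₂ potentialDeriv₃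
    field_simp
  rw [key]
  generalize t ^ (p - 2) = y at hy
  obtain ⟨m, rfl⟩ : ∃ m, p = m + 2 := ⟨p - 2, by ring⟩
  have hm : 0 < m := by linarith
  rcases lt_or_ge m 11 with h | h
  · have h1 : 0 < 6 * (2 * (m + 1) * (2 * m + 3)) - ((m + 1) * (m - 6)) ^ 2 := by
      have : 6 * (2 * (m + 1) * (2 * m + 3)) - ((m + 1) * (m - 6)) ^ 2
          = (m + 1) * m ^ 2 * (11 - m) := by ring
      rw [this]
      have : 0 < 11 - m := by linarith
      positivity
    nlinarith [sq_nonneg ((m + 1) * (m - 6) * y + 6), mul_pos h1 (pow_pos hy 2)]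
  · have h1 : 0 ≤ (m - 6) * y := mul_nonneg (by linarith) hy.le
    have h2 : 0 ≤ m * ((m - 6) * y) := mul_nonneg hm.le h1
    have h3 : 0 < (m + 1) * (2 * m + 3) * y ^ 2 := by positivity
    nlinarith

/-- Where `V'' > 0`, Chicone's criterion says that this function is positive. -/
lemma hasDerivAt_potential_sub (hp : 2 < p) (ht : 0 < t) :
    HasDerivAt (fun t => potential p t - 3 * potentialDeriv₂ p t * potentialDeriv p t ^ 2 /
        (6 * potentialDeriv₂ p t ^ 2 - 2 * potentialDeriv p t * potentialDeriv₃ p t))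
      (potentialDeriv p t ^ 3 * (2 * (p - 1) * (p - 2) * t ^ (p - 2) / t ^ 2 *
          ((p - 1) * (2 * p - 1) * t ^ (p - 2) + 3 * (p - 3))) /
        (6 * potentialDeriv₂ p t ^ 2 - 2 * potentialDeriv p t * potentialDeriv₃ p t) ^ 2) t := by
  have hA := (six_mul_sq_sub_pos hp ht).ne'
  have d0 := hasDerivAt_potential hp ht
  have d1 := hasDerivAt_potentialDeriv (p := p) ht
  have d2 := hasDerivAt_potentialDeriv₂ (p := p) ht
  have d3 := hasDerivAt_potentialDeriv₃ (p := p) ht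
  have d := d0.sub (((d2.const_mul 3).mul (d1.pow 2)).div
    (((d2.pow 2).const_mul 6).sub ((d1.const_mul 2).mul d3)) hA)
  refine d.congr_deriv ?_
  simp only [Pi.mul_apply, Pi.pow_apply, Pi.sub_apply, Nat.cast_ofNat]
  have hA2 := pow_ne_zero 2 hA
  rw [eq_div_iff hA2, sub_mul, div_mul_cancel₀ _ hA2]
  have e3 : potentialDeriv₃ p t = (p - 1) * (p - 2) * t ^ (p - 2) / t := rfl
  have e2 : potentialDeriv₂ p t = (p - 1) * t ^ (p - 2) - 1 := rfl
  rw [e3, e2]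
  unfold potentialDeriv
  generalize t ^ (p - 2) = y
  field_simp
  ring

/-- Chicone's criterion: `V / V' ^ 2` is convex. -/
lemma chicone_pos (hp : 2 < p) (ht : 0 < t) (ht1 : t ≠ 1) :
    0 < 6 * potential p t * potentialDeriv₂ p t ^ 2
      - 3 * potentialDeriv₂ p t * potentialDeriv p t ^ 2
      - 2 * potential p t * potentialDeriv p t * potentialDeriv₃ p t := by
  have hA := six_mul_sq_sub_pos hp ht
  have hV := potential_pos hp ht.le ht1
  rcases le_or_gt (potentialDeriv₂ p t) 0 with h2 | h2
  · nlinarith [mul_pos hV hA, mul_nonneg (neg_nonneg.2 h2) (sq_nonneg (potentialDeriv p t))]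
  · suffices h : 0 < potential p t - 3 * potentialDeriv₂ p t * potentialDeriv p t ^ 2 /
        (6 * potentialDeriv₂ p t ^ 2 - 2 * potentialDeriv p t * potentialDeriv₃ p t) by
      rw [sub_pos, div_lt_iff₀ hA] at h
      linarith
    have hfac : ∀ s, 0 < s → 0 < potentialDeriv₂ p s →
        0 < 2 * (p - 1) * (p - 2) * s ^ (p - 2) / s ^ 2 *
          ((p - 1) * (2 * p - 1) * s ^ (p - 2) + 3 * (p - 3)) /
          (6 * potentialDeriv₂ p s ^ 2 - 2 * potentialDeriv p s * potentialDeriv₃ p s) ^ 2 := by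
      intro s hs hs2
      have hy : 0 < s ^ (p - 2) := Real.rpow_pos_of_pos hs _
      have hA := six_mul_sq_sub_pos hp hs
      unfold potentialDeriv₂ at hs2
      have h1 : 0 < (p - 1) * (2 * p - 1) * s ^ (p - 2) + 3 * (p - 3) := by nlinarith
      have h2 : 0 < p - 1 := by linarith
      have h3 : 0 < p - 2 := by linarith
      positivity
    have h1 : (fun t => potential p t - 3 * potentialDeriv₂ p t * potentialDeriv p t ^ 2 /
        (6 * potentialDeriv₂ p t ^ 2 - 2 * potentialDeriv p t * potentialDeriv₃ p t)) 1 = 0 := by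
      simp [potential_one, potentialDeriv_one]
    have hd := fun s (hs : 0 < s) => hasDerivAt_potential_sub hp hs
    set W := fun t => potential p t - 3 * potentialDeriv₂ p t * potentialDeriv p t ^ 2 /
        (6 * potentialDeriv₂ p t ^ 2 - 2 * potentialDeriv p t * potentialDeriv₃ p t) with hW
    change 0 < W t
    rw [← h1]
    rcases ht1.lt_or_gt with h | h
    · refine strictAntiOn_of_deriv_neg (convex_Icc t 1) (fun s hs =>
        (hd s (ht.trans_le hs.1)).continuousAt.continuousWithinAt) ?_
        (left_mem_Icc.2 h.le) (right_mem_Icc.2 h.le) h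
      rw [interior_Icc]
      intro s hs
      have hs0 := ht.trans hs.1
      rw [(hd s hs0).deriv, mul_div_assoc]
      exact mul_neg_of_neg_of_pos (Odd.pow_neg (by decide) (potentialDeriv_neg hp hs0 hs.2))
        (hfac s hs0 (h2.trans (potentialDeriv₂_strictMonoOn hp ht hs0 hs.1)))
    · refine strictMonoOn_of_deriv_pos (convex_Icc 1 t) (fun s hs =>
        (hd s (one_pos.trans_le hs.1)).continuousAt.continuousWithinAt) ?_
        (left_mem_Icc.2 h.le) (right_mem_Icc.2 h.le) h
      rw [interior_Icc]
      intro s hs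
      have hs0 := one_pos.trans hs.1
      rw [(hd s hs0).deriv, mul_div_assoc]
      refine mul_pos (pow_pos (potentialDeriv_pos hp hs.1) 3) (hfac s hs0 ?_)
      refine lt_trans ?_ (potentialDeriv₂_strictMonoOn hp (mem_Ioi.2 one_pos) hs0 hs.1)
      rw [potentialDeriv₂_one]
      linarith

end Potential

section Chicone

variable {p t : ℝ}

lemma eventually_nhdsNE_one : ∀ᶠ t : ℝ in 𝓝[≠] 1, 0 < t ∧ t ≠ 1 :=
  ((lt_mem_nhds one_pos).filter_mono nhdsWithin_le_nhds).and self_mem_nhdsWithin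

lemma tendsto_nhdsNE_one_potentialDeriv₂ :
    Tendsto (potentialDeriv₂ p) (𝓝[≠] 1) (𝓝 (p - 2)) := by
  have := (hasDerivAt_potentialDeriv₂ (p := p) one_pos).continuousAt.tendsto
  rw [potentialDeriv₂_one] at this
  exact this.mono_left nhdsWithin_le_nhds

lemma tendsto_potential_div_sq (hp : 2 < p) :
    Tendsto (fun t => potential p t / potentialDeriv p t ^ 2) (𝓝[≠] 1)
      (𝓝 (1 / (2 * (p - 2)))) := by
  have hm : p - 2 ≠ 0 := by linarith
  have hV := (hasDerivAt_potential hp one_pos).continuousAt.tendsto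
  have hV1 := ((hasDerivAt_potentialDeriv (p := p) one_pos).continuousAt.pow 2).tendsto
  rw [potential_one] at hV
  rw [Pi.pow_apply, potentialDeriv_one, zero_pow two_ne_zero] at hV1
  have h2 := tendsto_nhdsNE_one_potentialDeriv₂ (p := p)
  have hne : ∀ᶠ t in 𝓝[≠] (1 : ℝ), potentialDeriv₂ p t ≠ 0 := h2.eventually_ne hm
  refine HasDerivAt.lhopital_zero_nhdsNE (f' := potentialDeriv p)
    (g' := fun t => 2 * potentialDeriv p t * potentialDeriv₂ p t) ?_ ?_ ?_
    (hV.mono_left nhdsWithin_le_nhds) (hV1.mono_left nhdsWithin_le_nhds) ?_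
  · filter_upwards [eventually_nhdsNE_one] with t ht using hasDerivAt_potential hp ht.1
  · filter_upwards [eventually_nhdsNE_one] with t ht
    exact ((hasDerivAt_potentialDeriv (p := p) ht.1).fun_pow 2).congr_deriv (by norm_num)
  · filter_upwards [eventually_nhdsNE_one, hne] with t ht h
    exact mul_ne_zero (mul_ne_zero two_ne_zero (potentialDeriv_ne_zero hp ht.1 ht.2)) h
  · refine ((tendsto_const_nhds (x := (1 : ℝ))).div (h2.const_mul 2)
      (mul_ne_zero two_ne_zero hm)).congr' ?_
    filter_upwards [eventually_nhdsNE_one, hne] with t ht h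
    have := potentialDeriv_ne_zero hp ht.1 ht.2
    simp only [Pi.div_apply]
    field_simp

/-- Chicone's quotient `V / V' ^ 2`, extended continuously to `t = 1`. -/
noncomputable def chiconeQuotient (p : ℝ) : ℝ → ℝ :=
  Function.update (fun t => potential p t / potentialDeriv p t ^ 2) 1 (1 / (2 * (p - 2)))

/-- The derivative of `chiconeQuotient p` away from `t = 1`. -/
noncomputable def chiconeDeriv (p t : ℝ) : ℝ :=
  (potentialDeriv p t ^ 2 - 2 * potential p t * potentialDeriv₂ p t) / potentialDeriv p t ^ 3

lemma chiconeQuotient_of_ne (ht : t ≠ 1) :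
    chiconeQuotient p t = potential p t / potentialDeriv p t ^ 2 :=
  Function.update_of_ne ht _ _

lemma chiconeQuotient_one (p : ℝ) : chiconeQuotient p 1 = 1 / (2 * (p - 2)) :=
  Function.update_self _ _ _

lemma hasDerivAt_chiconeQuotient (hp : 2 < p) (ht : 0 < t) (ht1 : t ≠ 1) :
    HasDerivAt (chiconeQuotient p) (chiconeDeriv p t) t := by
  have h1 := potentialDeriv_ne_zero hp ht ht1
  have h := (hasDerivAt_potential hp ht).div
    ((hasDerivAt_potentialDeriv (p := p) ht).pow 2) (pow_ne_zero 2 h1)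
  refine (h.congr_deriv ?_).congr_of_eventuallyEq ?_
  · simp only [Pi.pow_apply, chiconeDeriv]
    field_simp
    ring
  · filter_upwards [isOpen_ne.mem_nhds ht1] with s hs using chiconeQuotient_of_ne hs

lemma continuousAt_chiconeQuotient (hp : 2 < p) (ht : 0 < t) :
    ContinuousAt (chiconeQuotient p) t := by
  rcases eq_or_ne t 1 with rfl | h
  · exact continuousAt_update_same.2 (tendsto_potential_div_sq hp)
  · exact (hasDerivAt_chiconeQuotient hp ht h).continuousAt

lemma chiconeQuotient_pos (hp : 2 < p) (ht : 0 < t) : 0 < chiconeQuotient p t := by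
  rcases eq_or_ne t 1 with rfl | h
  · rw [chiconeQuotient_one]
    have : 0 < p - 2 := by linarith
    positivity
  · rw [chiconeQuotient_of_ne h]
    exact div_pos (potential_pos hp ht.le h) (sq_pos_of_ne_zero (potentialDeriv_ne_zero hp ht h))

lemma hasDerivAt_sq_sub (hp : 2 < p) (ht : 0 < t) :
    HasDerivAt (fun t => potentialDeriv p t ^ 2 - 2 * potential p t * potentialDeriv₂ p t)
      (-2 * potential p t * potentialDeriv₃ p t) t := by
  have h := ((hasDerivAt_potentialDeriv (p := p) ht).pow 2).sub
    (((hasDerivAt_potential hp ht).const_mul 2).mul (hasDerivAt_potentialDeriv₂ (p := p) ht))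
  refine h.congr_deriv ?_
  push_cast
  ring

lemma hasDerivAt_chiconeDeriv (hp : 2 < p) (ht : 0 < t) (ht1 : t ≠ 1) :
    HasDerivAt (chiconeDeriv p) ((6 * potential p t * potentialDeriv₂ p t ^ 2
      - 3 * potentialDeriv₂ p t * potentialDeriv p t ^ 2
      - 2 * potential p t * potentialDeriv p t * potentialDeriv₃ p t) / potentialDeriv p t ^ 4)
      t := by
  have h1 := potentialDeriv_ne_zero hp ht ht1
  refine ((hasDerivAt_sq_sub hp ht).div ((hasDerivAt_potentialDeriv (p := p) ht).pow 3)
    (pow_ne_zero 3 h1)).congr_deriv ?_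
  simp only [Pi.pow_apply]
  field_simp
  ring

lemma deriv_chiconeDeriv_pos (hp : 2 < p) (ht : 0 < t) (ht1 : t ≠ 1) :
    0 < deriv (chiconeDeriv p) t := by
  rw [(hasDerivAt_chiconeDeriv hp ht ht1).deriv]
  exact div_pos (chicone_pos hp ht ht1)
    (Even.pow_pos (by decide) (potentialDeriv_ne_zero hp ht ht1))

lemma strictMonoOn_chiconeDeriv_Ioo (hp : 2 < p) : StrictMonoOn (chiconeDeriv p) (Ioo 0 1) := by
  refine strictMonoOn_of_deriv_pos (convex_Ioo 0 1) (fun t ht =>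
    (hasDerivAt_chiconeDeriv hp ht.1 ht.2.ne).continuousAt.continuousWithinAt) fun t ht => ?_
  rw [interior_Ioo] at ht
  exact deriv_chiconeDeriv_pos hp ht.1 ht.2.ne

lemma strictMonoOn_chiconeDeriv_Ioi (hp : 2 < p) : StrictMonoOn (chiconeDeriv p) (Ioi 1) := by
  refine strictMonoOn_of_deriv_pos (convex_Ioi 1) (fun t ht =>
    (hasDerivAt_chiconeDeriv hp (one_pos.trans ht) (ne_of_gt ht)).continuousAt.continuousWithinAt)
    fun t ht => ?_
  rw [interior_Ioi] at ht
  exact deriv_chiconeDeriv_pos hp (one_pos.trans ht) (ne_of_gt ht)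

lemma exists_tendsto_chiconeDeriv (hp : 2 < p) :
    ∃ c, Tendsto (chiconeDeriv p) (𝓝[≠] 1) (𝓝 c) := by
  have hm : p - 2 ≠ 0 := by linarith
  have h2 := tendsto_nhdsNE_one_potentialDeriv₂ (p := p)
  have hne : ∀ᶠ t in 𝓝[≠] (1 : ℝ), potentialDeriv₂ p t ≠ 0 := h2.eventually_ne hm
  have h3 := (hasDerivAt_potentialDeriv₃ (p := p) one_pos).continuousAt.tendsto.mono_left
    (nhdsWithin_le_nhds (s := {1}ᶜ))
  have hN := (hasDerivAt_sq_sub hp one_pos).continuousAt.tendsto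
  have hV1 := ((hasDerivAt_potentialDeriv (p := p) one_pos).continuousAt.pow 3).tendsto
  simp only [Pi.pow_apply, potential_one, potentialDeriv_one] at hN hV1
  norm_num at hN hV1
  refine ⟨_, HasDerivAt.lhopital_zero_nhdsNE
    (f' := fun t => -2 * potential p t * potentialDeriv₃ p t)
    (g' := fun t => 3 * potentialDeriv p t ^ 2 * potentialDeriv₂ p t) ?_ ?_ ?_
    (hN.mono_left nhdsWithin_le_nhds) (hV1.mono_left nhdsWithin_le_nhds)
    (((((tendsto_potential_div_sq hp).mul h3).const_mul (-2 / 3)).div h2 hm).congr' ?_)⟩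
  · filter_upwards [eventually_nhdsNE_one] with t ht using hasDerivAt_sq_sub hp ht.1
  · filter_upwards [eventually_nhdsNE_one] with t ht
    exact ((hasDerivAt_potentialDeriv (p := p) ht.1).fun_pow 3).congr_deriv (by norm_num)
  · filter_upwards [eventually_nhdsNE_one, hne] with t ht h
    exact mul_ne_zero (mul_ne_zero three_ne_zero
      (pow_ne_zero 2 (potentialDeriv_ne_zero hp ht.1 ht.2))) h
  · filter_upwards [eventually_nhdsNE_one, hne] with t ht h
    have := potentialDeriv_ne_zero hp ht.1 ht.2
    simp only [Pi.div_apply]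
    field_simp

lemma chiconeDeriv_lt {s : ℝ} (hp : 2 < p) (hs0 : 0 < s) (hs : s < 1) (ht : 1 < t) :
    chiconeDeriv p s < chiconeDeriv p t := by
  obtain ⟨c, hc⟩ := exists_tendsto_chiconeDeriv hp
  have hl := hc.mono_left (nhdsLT_le_nhdsNE 1)
  have hr := hc.mono_left (nhdsGT_le_nhdsNE 1)
  have hleft : ∀ u, 0 < u → u < 1 → chiconeDeriv p u ≤ c := fun u hu0 hu =>
    ge_of_tendsto hl <| by
      filter_upwards [Ioo_mem_nhdsLT hu] with x hx
      exact (strictMonoOn_chiconeDeriv_Ioo hp ⟨hu0, hu⟩ ⟨hu0.trans hx.1, hx.2⟩ hx.1).le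
  have hright : c ≤ chiconeDeriv p t := le_of_tendsto hr <| by
      filter_upwards [Ioo_mem_nhdsGT ht] with x hx
      exact (strictMonoOn_chiconeDeriv_Ioi hp hx.1 ht hx.2).le
  obtain ⟨u, hsu, hu⟩ := exists_between hs
  exact (strictMonoOn_chiconeDeriv_Ioo hp ⟨hs0, hs⟩ ⟨hs0.trans hsu, hu⟩ hsu).trans_le
    ((hleft u (hs0.trans hsu) hu).trans hright)

end Chicone

section SignedRoot

variable {p t : ℝ}

/-- The increasing square root of the potential: negative to the left of `1`, positive to the
right. -/
noncomputable def signedRoot (p t : ℝ) : ℝ :=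
  if t ≤ 1 then -√(potential p t) else √(potential p t)

lemma signedRoot_of_le (ht : t ≤ 1) : signedRoot p t = -√(potential p t) := if_pos ht

lemma signedRoot_of_gt (ht : 1 < t) : signedRoot p t = √(potential p t) := if_neg ht.not_ge

lemma signedRoot_one (p : ℝ) : signedRoot p 1 = 0 := by
  simp [signedRoot_of_le, potential_one]

lemma signedRoot_sq (hp : 2 < p) (ht : 0 ≤ t) : signedRoot p t ^ 2 = potential p t := by
  have := potential_nonneg hp ht
  unfold signedRoot
  split_ifs <;> simp [Real.sq_sqrt this]

lemma continuous_signedRoot (hp : 2 < p) : Continuous (signedRoot p) := by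
  have := continuous_potential hp
  refine Continuous.if_le (by fun_prop) (by fun_prop) continuous_id continuous_const ?_
  rintro x rfl
  simp [potential_one]

lemma strictMonoOn_signedRoot (hp : 2 < p) : StrictMonoOn (signedRoot p) (Ici 0) := by
  have h1 : StrictMonoOn (signedRoot p) (Icc 0 1) := fun s hs t ht hst => by
    rw [signedRoot_of_le hs.2, signedRoot_of_le ht.2, neg_lt_neg_iff]
    exact Real.sqrt_lt_sqrt (potential_nonneg hp ht.1) (strictAntiOn_potential hp hs ht hst)
  have h2 : StrictMonoOn (signedRoot p) (Ici 1) := fun s hs t ht hst => by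
    have ht1 : 1 < t := lt_of_le_of_lt hs hst
    rw [signedRoot_of_gt ht1]
    rcases eq_or_lt_of_le (mem_Ici.1 hs) with rfl | h
    · rw [signedRoot_one]
      exact Real.sqrt_pos.2 (potential_pos hp (by linarith) ht1.ne')
    · rw [signedRoot_of_gt h]
      exact Real.sqrt_lt_sqrt (potential_nonneg hp (by linarith))
        (strictMonoOn_potential hp hs ht hst)
  rw [← Icc_union_Ici_eq_Ici zero_le_one]
  exact h1.union h2 (isGreatest_Icc zero_le_one) isLeast_Ici

lemma hasDerivAt_signedRoot_of_ne (hp : 2 < p) (ht : 0 < t) (ht1 : t ≠ 1) :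
    HasDerivAt (signedRoot p) (2 * √(chiconeQuotient p t))⁻¹ t := by
  have hV := potential_pos hp ht.le ht1
  have hd := (hasDerivAt_potential hp ht).sqrt hV.ne'
  rw [chiconeQuotient_of_ne ht1, Real.sqrt_div hV.le, Real.sqrt_sq_eq_abs]
  rcases ht1.lt_or_gt with h | h
  · refine (hd.neg.congr_deriv ?_).congr_of_eventuallyEq ?_
    · rw [abs_of_neg (potentialDeriv_neg hp ht h), mul_inv, inv_div]
      ring
    · filter_upwards [Iio_mem_nhds h] with s hs using signedRoot_of_le (le_of_lt hs)
  · refine (hd.congr_deriv ?_).congr_of_eventuallyEq ?_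
    · rw [abs_of_pos (potentialDeriv_pos hp h), mul_inv, inv_div]
      ring
    · filter_upwards [Ioi_mem_nhds h] with s hs using signedRoot_of_gt hs

lemma hasDerivAt_signedRoot (hp : 2 < p) (ht : 0 < t) :
    HasDerivAt (signedRoot p) (2 * √(chiconeQuotient p t))⁻¹ t := by
  rcases eq_or_ne t 1 with rfl | h
  · have hK := (continuousAt_chiconeQuotient hp one_pos).sqrt
    have hpos := Real.sqrt_pos.2 (chiconeQuotient_pos hp one_pos)
    have hS : Tendsto (fun t => signedRoot p t - signedRoot p 1) (𝓝 1) (𝓝 0) := by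
      have := continuous_signedRoot hp
      exact Continuous.tendsto' (by fun_prop) _ _ (sub_self _)
    have hI : Tendsto (fun t : ℝ => t - 1) (𝓝 1) (𝓝 0) :=
      Continuous.tendsto' (by fun_prop) _ _ (sub_self _)
    rw [hasDerivAt_iff_tendsto_slope]
    simp only [slope_fun_def_field]
    refine HasDerivAt.lhopital_zero_nhdsNE (f' := fun t => (2 * √(chiconeQuotient p t))⁻¹)
      (g' := fun _ => 1) ?_ (.of_forall fun t => (hasDerivAt_id t).sub_const 1)
      (.of_forall fun _ => one_ne_zero)
      (hS.mono_left nhdsWithin_le_nhds) (hI.mono_left nhdsWithin_le_nhds) ?_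
    · filter_upwards [eventually_nhdsNE_one] with t ht
      exact (hasDerivAt_signedRoot_of_ne hp ht.1 ht.2).sub_const _
    · simp only [div_one]
      exact ((hK.const_mul 2).inv₀ (by positivity)).tendsto.mono_left nhdsWithin_le_nhds
  · exact hasDerivAt_signedRoot_of_ne hp ht h

end SignedRoot

section Inverse

variable {p s t r : ℝ}

/-- Half-width `√f(1)` of the range of `signedRoot p` on the well. -/
noncomputable def wellRadius (p : ℝ) : ℝ := √(f p 1)

/-- The inverse of `signedRoot p` on the well. -/
noncomputable def wellInverse (p : ℝ) : ℝ → ℝ :=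
  Function.invFunOn (signedRoot p) (Ioo 0 (wellEnd p))

/-- The derivative of `wellInverse p`. -/
noncomputable def wellSpeed (p s : ℝ) : ℝ := 2 * √(chiconeQuotient p (wellInverse p s))

lemma wellRadius_pos (hp : 2 < p) : 0 < wellRadius p := Real.sqrt_pos.2 (f_one_pos hp)

lemma signedRoot_zero (hp : 2 < p) : signedRoot p 0 = -wellRadius p := by
  rw [signedRoot_of_le zero_le_one, potential_zero hp, wellRadius]

lemma signedRoot_wellEnd (hp : 2 < p) : signedRoot p (wellEnd p) = wellRadius p := by
  rw [signedRoot_of_gt (one_lt_wellEnd hp), potential_wellEnd hp, wellRadius]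

lemma signedRoot_mem (hp : 2 < p) (ht : t ∈ Ioo 0 (wellEnd p)) :
    signedRoot p t ∈ Ioo (-wellRadius p) (wellRadius p) := by
  have hB : 0 < wellEnd p := zero_lt_one.trans (one_lt_wellEnd hp)
  rw [← signedRoot_zero hp, ← signedRoot_wellEnd hp]
  exact ⟨strictMonoOn_signedRoot hp self_mem_Ici ht.1.le ht.1,
    strictMonoOn_signedRoot hp ht.1.le hB.le ht.2⟩

lemma surjOn_signedRoot (hp : 2 < p) :
    SurjOn (signedRoot p) (Ioo 0 (wellEnd p)) (Ioo (-wellRadius p) (wellRadius p)) := by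
  have hB : 0 < wellEnd p := zero_lt_one.trans (one_lt_wellEnd hp)
  have := intermediate_value_Ioo hB.le (continuous_signedRoot hp).continuousOn
  rwa [signedRoot_zero hp, signedRoot_wellEnd hp] at this

lemma wellInverse_mem (hp : 2 < p) (hs : s ∈ Ioo (-wellRadius p) (wellRadius p)) :
    wellInverse p s ∈ Ioo 0 (wellEnd p) :=
  Function.invFunOn_mem (surjOn_signedRoot hp hs)

lemma signedRoot_wellInverse (hp : 2 < p) (hs : s ∈ Ioo (-wellRadius p) (wellRadius p)) :
    signedRoot p (wellInverse p s) = s :=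
  Function.invFunOn_eq (surjOn_signedRoot hp hs)

lemma wellInverse_signedRoot (hp : 2 < p) (ht : t ∈ Ioo 0 (wellEnd p)) :
    wellInverse p (signedRoot p t) = t :=
  (strictMonoOn_signedRoot hp).injOn (wellInverse_mem hp (signedRoot_mem hp ht)).1.le ht.1.le
    (signedRoot_wellInverse hp (signedRoot_mem hp ht))

lemma potential_wellInverse (hp : 2 < p) (hs : s ∈ Ioo (-wellRadius p) (wellRadius p)) :
    potential p (wellInverse p s) = s ^ 2 := by
  rw [← signedRoot_sq hp (wellInverse_mem hp hs).1.le, signedRoot_wellInverse hp hs]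

lemma wellInverse_zero (hp : 2 < p) : wellInverse p 0 = 1 := by
  rw [← signedRoot_one p, wellInverse_signedRoot hp ⟨one_pos, one_lt_wellEnd hp⟩]

lemma strictMonoOn_wellInverse (hp : 2 < p) :
    StrictMonoOn (wellInverse p) (Ioo (-wellRadius p) (wellRadius p)) := fun s hs t ht hst => by
  refine ((strictMonoOn_signedRoot hp).lt_iff_lt (wellInverse_mem hp hs).1.le
    (wellInverse_mem hp ht).1.le).1 ?_
  rwa [signedRoot_wellInverse hp hs, signedRoot_wellInverse hp ht]

lemma continuousAt_wellInverse (hp : 2 < p) (hs : s ∈ Ioo (-wellRadius p) (wellRadius p)) :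
    ContinuousAt (wellInverse p) s := by
  refine (strictMonoOn_wellInverse hp).continuousAt_of_image_mem_nhds (Ioo_mem_nhds hs.1 hs.2) ?_
  have h := wellInverse_mem hp hs
  refine mem_of_superset (Ioo_mem_nhds h.1 h.2) fun t ht => ?_
  exact ⟨_, signedRoot_mem hp ht, wellInverse_signedRoot hp ht⟩

lemma wellSpeed_pos (hp : 2 < p) (hs : s ∈ Ioo (-wellRadius p) (wellRadius p)) :
    0 < wellSpeed p s :=
  mul_pos two_pos (Real.sqrt_pos.2 (chiconeQuotient_pos hp (wellInverse_mem hp hs).1))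

lemma hasDerivAt_wellInverse (hp : 2 < p) (hs : s ∈ Ioo (-wellRadius p) (wellRadius p)) :
    HasDerivAt (wellInverse p) (wellSpeed p s) s := by
  have h := HasDerivAt.of_local_left_inverse (continuousAt_wellInverse hp hs)
    (hasDerivAt_signedRoot hp (wellInverse_mem hp hs).1)
    (inv_ne_zero (wellSpeed_pos hp hs).ne') <| by
      filter_upwards [Ioo_mem_nhds hs.1 hs.2] with u hu using signedRoot_wellInverse hp hu
  rwa [inv_inv] at h

lemma continuousAt_wellSpeed (hp : 2 < p) (hs : s ∈ Ioo (-wellRadius p) (wellRadius p)) :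
    ContinuousAt (wellSpeed p) s :=
  ((ContinuousAt.comp (continuousAt_chiconeQuotient hp (wellInverse_mem hp hs).1)
    (continuousAt_wellInverse hp hs)).sqrt).const_mul 2

lemma wellInverse_gt_one (hp : 2 < p) (hs0 : 0 < s) (hs : s < wellRadius p) :
    1 < wellInverse p s := by
  have hS := wellRadius_pos hp
  rw [← wellInverse_zero hp]
  exact strictMonoOn_wellInverse hp ⟨by linarith, hS⟩ ⟨by linarith, hs⟩ hs0

lemma wellInverse_lt_one (hp : 2 < p) (hs0 : s < 0) (hs : -wellRadius p < s) :
    wellInverse p s < 1 := by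
  have hS := wellRadius_pos hp
  rw [← wellInverse_zero hp]
  exact strictMonoOn_wellInverse hp ⟨hs, by linarith⟩ ⟨by linarith, hS⟩ hs0

lemma hasDerivAt_wellSpeed (hp : 2 < p) (hs : s ∈ Ioo (-wellRadius p) (wellRadius p))
    (hs0 : s ≠ 0) :
    HasDerivAt (wellSpeed p) (2 * chiconeDeriv p (wellInverse p s)) s := by
  have hg := wellInverse_mem hp hs
  have hne : wellInverse p s ≠ 1 := hs0.lt_or_gt.elim
    (fun h => (wellInverse_lt_one hp h hs.1).ne) fun h => (wellInverse_gt_one hp h hs.2).ne'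
  have hK := chiconeQuotient_pos hp hg.1
  have h := (((hasDerivAt_chiconeQuotient hp hg.1 hne).comp s
    (hasDerivAt_wellInverse hp hs)).sqrt hK.ne').const_mul 2
  refine h.congr_deriv ?_
  have := Real.sqrt_pos.2 hK
  simp only [Function.comp_apply, wellSpeed]
  field_simp

lemma strictMonoOn_wellSpeed_add (hp : 2 < p) :
    StrictMonoOn (fun s => wellSpeed p s + wellSpeed p (-s)) (Ico 0 (wellRadius p)) := by
  have hS := wellRadius_pos hp
  refine strictMonoOn_of_deriv_pos (convex_Ico _ _) (fun s hs => ?_) fun s hs => ?_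
  · have h1 : ContinuousAt (wellSpeed p) s :=
      continuousAt_wellSpeed hp ⟨by linarith [hs.1], hs.2⟩
    have h2 : ContinuousAt (wellSpeed p) (-s) :=
      continuousAt_wellSpeed hp ⟨by linarith [hs.2], by linarith [hs.1]⟩
    exact (h1.add (h2.comp continuous_neg.continuousAt)).continuousWithinAt
  · rw [interior_Ico] at hs
    have hs' : -s ∈ Ioo (-wellRadius p) (wellRadius p) := ⟨by linarith [hs.2], by linarith [hs.1]⟩
    have h1 := hasDerivAt_wellSpeed hp ⟨by linarith [hs.1], hs.2⟩ hs.1.ne'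
    have h2 := (hasDerivAt_wellSpeed hp hs' (by linarith [hs.1])).comp s (hasDerivAt_neg s)
    have h3 := chiconeDeriv_lt hp (wellInverse_mem hp hs').1
      (wellInverse_lt_one hp (by linarith [hs.1]) hs'.1) (wellInverse_gt_one hp hs.1 hs.2)
    have h4 := (h1.add h2).deriv
    have h5 : (fun s => wellSpeed p s + wellSpeed p (-s))
        = wellSpeed p + wellSpeed p ∘ Neg.neg := rfl
    rw [h5, h4]
    linarith

end Inverse

section HalfPeriod

open Real

variable {p r : ℝ}

/-- The half period of the oscillation of amplitude `r` in the coordinate `signedRoot p`. -/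
noncomputable def halfPeriod (p r : ℝ) : ℝ := ∫ θ in (-(π / 2))..(π / 2), wellSpeed p (r * sin θ)

lemma mul_sin_mem (hr0 : 0 ≤ r) (hr : r < wellRadius p) (θ : ℝ) :
    r * sin θ ∈ Ioo (-wellRadius p) (wellRadius p) := by
  have := neg_one_le_sin θ
  have := sin_le_one θ
  constructor <;> nlinarith

lemma continuous_wellSpeed_mul_sin (hp : 2 < p) (hr0 : 0 ≤ r) (hr : r < wellRadius p) :
    Continuous fun θ => wellSpeed p (r * sin θ) :=
  continuous_iff_continuousAt.2 fun θ => ContinuousAt.comp (g := wellSpeed p)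
    (continuousAt_wellSpeed hp (mul_sin_mem hr0 hr θ)) (by fun_prop)

lemma two_mul_halfPeriod (hp : 2 < p) (hr0 : 0 ≤ r) (hr : r < wellRadius p) :
    2 * halfPeriod p r =
      ∫ θ in (-(π / 2))..(π / 2), (wellSpeed p |r * sin θ| + wellSpeed p (-|r * sin θ|)) := by
  have hc := continuous_wellSpeed_mul_sin hp hr0 hr
  have hn : ∫ θ in (-(π / 2))..(π / 2), wellSpeed p (r * sin (-θ)) = halfPeriod p r := by
    rw [intervalIntegral.integral_comp_neg fun θ => wellSpeed p (r * sin θ), neg_neg, halfPeriod]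
  rw [two_mul]
  nth_rw 2 [← hn]
  have hc' : Continuous fun θ => wellSpeed p (r * sin (-θ)) := hc.comp continuous_neg
  rw [halfPeriod, ← intervalIntegral.integral_add (hc.intervalIntegrable _ _)
    (hc'.intervalIntegrable _ _)]
  congr 1 with θ
  rw [sin_neg, mul_neg]
  rcases abs_cases (r * sin θ) with h | h <;> rw [h.1]
  rw [neg_neg, add_comm]

lemma strictMonoOn_halfPeriod (hp : 2 < p) : StrictMonoOn (halfPeriod p) (Ico 0 (wellRadius p)) := by
  intro r hr R hR hrR
  refine lt_of_mul_lt_mul_left ?_ (zero_le_two (α := ℝ))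
  rw [two_mul_halfPeriod hp hr.1 hr.2, two_mul_halfPeriod hp hR.1 hR.2]
  have hc : ∀ r ∈ Ico 0 (wellRadius p), Continuous fun θ =>
      wellSpeed p |r * sin θ| + wellSpeed p (-|r * sin θ|) := fun r hr =>
    continuous_iff_continuousAt.2 fun θ => by
      have h := abs_lt.2 (mul_sin_mem hr.1 hr.2 θ)
      have h0 := abs_nonneg (r * sin θ)
      have h1 : ContinuousAt (wellSpeed p) |r * sin θ| :=
        continuousAt_wellSpeed hp ⟨by linarith, h⟩
      have h2 : ContinuousAt (wellSpeed p) (-|r * sin θ|) :=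
        continuousAt_wellSpeed hp ⟨by linarith, by linarith⟩
      exact (ContinuousAt.comp (f := fun θ => |r * sin θ|) (x := θ) h1 (by fun_prop)).add
        (ContinuousAt.comp (f := fun θ => -|r * sin θ|) (x := θ) h2 (by fun_prop))
  have hmem : ∀ r ∈ Ico 0 (wellRadius p), ∀ θ, |r * sin θ| ∈ Ico 0 (wellRadius p) :=
    fun r hr θ => ⟨abs_nonneg _, abs_lt.2 (mul_sin_mem hr.1 hr.2 θ)⟩
  refine intervalIntegral.integral_lt_integral_of_continuousOn_of_le_of_exists_lt
    (by linarith [pi_pos]) (hc r hr).continuousOn (hc R hR).continuousOn (fun θ _ => ?_)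
    ⟨π / 2, ⟨by linarith [pi_pos], le_rfl⟩, ?_⟩
  · refine (strictMonoOn_wellSpeed_add hp).monotoneOn (hmem r hr θ) (hmem R hR θ) ?_
    rw [abs_mul, abs_mul, abs_of_nonneg hr.1, abs_of_nonneg hR.1]
    exact mul_le_mul_of_nonneg_right hrR.le (abs_nonneg _)
  · refine strictMonoOn_wellSpeed_add hp (hmem r hr _) (hmem R hR _) ?_
    simpa [abs_of_nonneg hr.1, abs_of_nonneg hR.1] using hrR

lemma continuousOn_halfPeriod (hp : 2 < p) (hr0 : 0 ≤ r) (hr : r < wellRadius p) :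
    ContinuousOn (halfPeriod p) (Icc 0 r) := by
  have hle : -r ≤ r := by linarith
  have hc : ContinuousOn (wellSpeed p) (Icc (-r) r) := fun s hs =>
    (continuousAt_wellSpeed hp ⟨by linarith [hs.1], by linarith [hs.2]⟩).continuousWithinAt
  have hext : Continuous (IccExtend hle ((Icc (-r) r).domRestrict (wellSpeed p))) :=
    (continuousOn_iff_continuous_domRestrict.1 hc).Icc_extend'
  have hcont : Continuous fun u => ∫ θ in (-(π / 2))..(π / 2),
      IccExtend hle ((Icc (-r) r).domRestrict (wellSpeed p)) (u * sin θ) :=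
    intervalIntegral.continuous_parametric_intervalIntegral_of_continuous' (by fun_prop) _ _
  refine hcont.continuousOn.congr fun u hu => ?_
  refine intervalIntegral.integral_congr fun θ _ => ?_
  have := neg_one_le_sin θ
  have := sin_le_one θ
  have hmem : u * sin θ ∈ Icc (-r) r := by
    constructor <;> nlinarith [hu.1, hu.2]
  exact (IccExtend_of_mem hle ((Icc (-r) r).domRestrict (wellSpeed p)) hmem).symm

lemma halfPeriod_zero (hp : 2 < p) : 1 / √2 * halfPeriod p 0 = π / √(p - 2) := by
  have hm : 0 < p - 2 := by linarith
  have h : wellSpeed p 0 = 2 / (√2 * √(p - 2)) := by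
    rw [wellSpeed, wellInverse_zero hp, chiconeQuotient_one, sqrt_div zero_le_one,
      sqrt_mul zero_le_two, sqrt_one, mul_one_div]
  simp only [halfPeriod, zero_mul, intervalIntegral.integral_const, h, smul_eq_mul]
  have h2 : √2 * √2 = 2 := mul_self_sqrt zero_le_two
  have := sqrt_pos.2 hm
  field_simp
  nlinarith

lemma hasDerivAt_wellInverse_mul_sin (hp : 2 < p) (hr0 : 0 ≤ r) (hr : r < wellRadius p) (θ : ℝ) :
    HasDerivAt (fun θ => wellInverse p (r * sin θ)) (wellSpeed p (r * sin θ) * (r * cos θ)) θ :=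
  (hasDerivAt_wellInverse hp (mul_sin_mem hr0 hr θ)).comp θ ((hasDerivAt_sin θ).const_mul r)

lemma strictMonoOn_wellInverse_mul_sin (hp : 2 < p) (hr0 : 0 < r) (hr : r < wellRadius p) :
    StrictMonoOn (fun θ => wellInverse p (r * sin θ)) (Icc (-(π / 2)) (π / 2)) :=
  fun θ hθ ψ hψ h => strictMonoOn_wellInverse hp (mul_sin_mem hr0.le hr θ)
    (mul_sin_mem hr0.le hr ψ) (mul_lt_mul_of_pos_left (strictMonoOn_sin hθ hψ h) hr0)

lemma image_wellInverse_mul_sin (hp : 2 < p) (hr0 : 0 < r) (hr : r < wellRadius p) :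
    (fun θ => wellInverse p (r * sin θ)) '' Ioo (-(π / 2)) (π / 2)
      = Ioo (wellInverse p (-r)) (wellInverse p r) := by
  have hle : -(π / 2) ≤ π / 2 := by linarith [pi_pos]
  have hmono := strictMonoOn_wellInverse_mul_sin hp hr0 hr
  have hc : ContinuousOn (fun θ => wellInverse p (r * sin θ)) (Icc (-(π / 2)) (π / 2)) :=
    fun θ _ => (hasDerivAt_wellInverse_mul_sin hp hr0.le hr θ).continuousAt.continuousWithinAt
  have e1 : wellInverse p (-r) = wellInverse p (r * sin (-(π / 2))) := by simp
  have e2 : wellInverse p r = wellInverse p (r * sin (π / 2)) := by simp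
  rw [e1, e2]
  refine Subset.antisymm ?_ (intermediate_value_Ioo hle hc)
  rintro _ ⟨θ, hθ, rfl⟩
  exact ⟨hmono (left_mem_Icc.2 hle) (Ioo_subset_Icc_self hθ) hθ.1,
    hmono (Ioo_subset_Icc_self hθ) (right_mem_Icc.2 hle) hθ.2⟩

lemma abs_deriv_smul_inv_sqrt (hp : 2 < p) (hr0 : 0 < r) (hr : r < wellRadius p) {θ : ℝ}
    (hθ : θ ∈ Ioo (-(π / 2)) (π / 2)) :
    |wellSpeed p (r * sin θ) * (r * cos θ)| •
      (1 / √(r ^ 2 - potential p (wellInverse p (r * sin θ)))) = wellSpeed p (r * sin θ) := by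
  have hmem := mul_sin_mem hr0.le hr θ
  have hcos : 0 < r * cos θ := mul_pos hr0 (cos_pos_of_mem_Ioo hθ)
  have h : r ^ 2 - (r * sin θ) ^ 2 = (r * cos θ) ^ 2 := by
    rw [mul_pow, mul_pow, cos_sq']; ring
  rw [potential_wellInverse hp hmem, h, sqrt_sq hcos.le,
    abs_of_pos (mul_pos (wellSpeed_pos hp hmem) hcos), smul_eq_mul,
    mul_one_div, mul_div_cancel_right₀ _ hcos.ne']

lemma integrableOn_inv_sqrt (hp : 2 < p) (hr0 : 0 < r) (hr : r < wellRadius p) :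
    IntegrableOn (fun t => 1 / √(r ^ 2 - potential p t))
      (Ioo (wellInverse p (-r)) (wellInverse p r)) := by
  rw [← image_wellInverse_mul_sin hp hr0 hr, integrableOn_image_iff_integrableOn_abs_deriv_smul
    measurableSet_Ioo
    (fun θ _ => (hasDerivAt_wellInverse_mul_sin hp hr0.le hr θ).hasDerivWithinAt)
    ((strictMonoOn_wellInverse_mul_sin hp hr0 hr).injOn.mono Ioo_subset_Icc_self)]
  refine IntegrableOn.congr_fun ?_ (fun θ hθ => (abs_deriv_smul_inv_sqrt hp hr0 hr hθ).symm)
    measurableSet_Ioo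
  exact ((continuous_wellSpeed_mul_sin hp hr0.le hr).integrableOn_Icc).mono_set Ioo_subset_Icc_self

lemma integral_inv_sqrt (hp : 2 < p) (hr0 : 0 < r) (hr : r < wellRadius p) :
    ∫ t in Ioo (wellInverse p (-r)) (wellInverse p r), 1 / √(r ^ 2 - potential p t)
      = halfPeriod p r := by
  rw [← image_wellInverse_mul_sin hp hr0 hr, integral_image_eq_integral_abs_deriv_smul
    measurableSet_Ioo
    (fun θ _ => (hasDerivAt_wellInverse_mul_sin hp hr0.le hr θ).hasDerivWithinAt)
    ((strictMonoOn_wellInverse_mul_sin hp hr0 hr).injOn.mono Ioo_subset_Icc_self),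
    halfPeriod, intervalIntegral.integral_of_le (by linarith [pi_pos]),
    integral_Ioc_eq_integral_Ioo]
  exact setIntegral_congr_fun measurableSet_Ioo fun θ hθ => abs_deriv_smul_inv_sqrt hp hr0 hr hθ

end HalfPeriod

section Length

open Real

variable {p z : ℝ}

lemma sqrt_potential_pos (hp : 2 < p) (hz : 0 < z) (hz1 : z ≠ 1) : 0 < √(potential p z) :=
  sqrt_pos.2 (potential_pos hp hz.le hz1)

lemma sqrt_potential_lt (hp : 2 < p) (hz : z ∈ Ioo 0 (wellEnd p)) :
    √(potential p z) < wellRadius p := by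
  have h := signedRoot_mem hp hz
  rw [← signedRoot_sq hp hz.1.le, sqrt_sq_eq_abs]
  exact abs_lt.2 h

lemma wellInverse_neg_sqrt_potential (hp : 2 < p) (hz : z ∈ Ioo (0 : ℝ) 1) :
    wellInverse p (-√(potential p z)) = z := by
  rw [← signedRoot_of_le hz.2.le,
    wellInverse_signedRoot hp ⟨hz.1, hz.2.trans (one_lt_wellEnd hp)⟩]

lemma wellInverse_sqrt_potential (hp : 2 < p) (hz : z ∈ Ioo 1 (wellEnd p)) :
    wellInverse p √(potential p z) = z := by
  rw [← signedRoot_of_gt hz.1, wellInverse_signedRoot hp ⟨one_pos.trans hz.1, hz.2⟩]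

lemma length_eq_halfPeriod (hp : 2 < p) {a b : ℝ} (hz : z ∈ Ioo 0 (wellEnd p) \ {1})
    (ha : a ∈ Ioo (0 : ℝ) 1) (hb : b ∈ Ioo 1 (wellEnd p)) (hfa : f p a = f p z)
    (hfb : f p b = f p z) :
    ∫ t in a..b, 1 / √(f p t - f p z) = halfPeriod p √(potential p z) := by
  have ha' := wellInverse_neg_sqrt_potential hp ha
  have hb' := wellInverse_sqrt_potential hp hb
  rw [potential, hfa, ← potential] at ha'
  rw [potential, hfb, ← potential] at hb'
  rw [← integral_inv_sqrt hp (sqrt_potential_pos hp hz.1.1 hz.2) (sqrt_potential_lt hp hz.1),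
    ha', hb', intervalIntegral.integral_of_le (ha.2.trans hb.1).le, integral_Ioc_eq_integral_Ioo,
    sq_sqrt (potential_nonneg hp hz.1.1.le)]
  simp only [potential, sub_sub_sub_cancel_left]

lemma neg_log_le_halfPeriod (hp : 2 < p) (hz : z ∈ Ioo (0 : ℝ) 1) :
    √2 * -log z ≤ halfPeriod p √(potential p z) := by
  have hz' : z ∈ Ioo 0 (wellEnd p) := ⟨hz.1, hz.2.trans (one_lt_wellEnd hp)⟩
  have hr0 := sqrt_potential_pos hp hz.1 hz.2.ne
  have hr := sqrt_potential_lt hp hz'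
  have hint := integrableOn_inv_sqrt hp hr0 hr
  have hsub : Ioo z 1 ⊆ Ioo z (wellInverse p √(potential p z)) :=
    Ioo_subset_Ioo_right (wellInverse_gt_one hp hr0 hr).le
  rw [← integral_inv_sqrt hp hr0 hr, wellInverse_neg_sqrt_potential hp hz]
  rw [wellInverse_neg_sqrt_potential hp hz] at hint
  have hlog : ∫ t in Ioo z 1, √2 * (1 / t) = √2 * -log z := by
    rw [← integral_Ioc_eq_integral_Ioo, ← intervalIntegral.integral_of_le hz.2.le,
      intervalIntegral.integral_const_mul, integral_one_div_of_pos hz.1 one_pos, one_div, log_inv]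
  have hlogint : IntegrableOn (fun t => √2 * (1 / t)) (Ioo z 1) := by
    refine (ContinuousOn.integrableOn_Icc ?_).mono_set Ioo_subset_Icc_self
    exact continuousOn_const.mul (continuousOn_const.div continuousOn_id fun t ht =>
      (hz.1.trans_le ht.1).ne')
  rw [← hlog]
  refine (setIntegral_mono_on hlogint (hint.mono_set hsub) measurableSet_Ioo fun t ht => ?_).trans
    (setIntegral_mono_set hint (.of_forall fun t => by positivity) hsub.eventuallyLE)
  have ht0 : 0 < t := hz.1.trans ht.1
  have hpos : 0 < potential p z - potential p t :=
    sub_pos.2 (strictAntiOn_potential hp ⟨hz.1.le, hz.2.le⟩ ⟨ht0.le, ht.2.le⟩ ht.1)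
  have hle : potential p z - potential p t ≤ t ^ 2 / 2 := by
    have h1 : z ^ p / p ≤ t ^ p / p :=
      div_le_div_of_nonneg_right (rpow_le_rpow hz.1.le ht.1.le (by linarith)) (by linarith)
    unfold potential f
    nlinarith [sq_nonneg z]
  rw [sq_sqrt (potential_nonneg hp hz.1.le)]
  calc √2 * (1 / t) = 1 / √(t ^ 2 / 2) := by
        rw [sqrt_div' _ zero_le_two, sqrt_sq ht0.le, one_div_div, mul_one_div]
    _ ≤ _ := one_div_le_one_div_of_le (sqrt_pos.2 hpos) (sqrt_le_sqrt hle)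

lemma exists_halfPeriod_eq (hp : 2 < p) {ℓ : ℝ} (hℓ : π / √(p - 2) < ℓ) :
    ∃ r ∈ Ioo 0 (wellRadius p), 1 / √2 * halfPeriod p r = ℓ := by
  have hℓ0 : 0 < ℓ := lt_of_le_of_lt (by positivity) hℓ
  have hz : exp (-ℓ) ∈ Ioo (0 : ℝ) 1 := ⟨exp_pos _, by simpa using hℓ0⟩
  have hR0 := sqrt_potential_pos hp hz.1 hz.2.ne
  have hR := sqrt_potential_lt hp ⟨hz.1, hz.2.trans (one_lt_wellEnd hp)⟩
  have hlow := neg_log_le_halfPeriod hp hz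
  rw [log_exp, neg_neg] at hlow
  have hc := (continuousOn_halfPeriod hp hR0.le hR).const_smul (1 / √2)
  have h2 : ℓ ≤ 1 / √2 * halfPeriod p √(potential p (exp (-ℓ))) := by
    rw [one_div_mul_eq_div, le_div_iff₀ (by positivity), mul_comm]
    exact hlow
  obtain ⟨r, hr, hrℓ⟩ := intermediate_value_Icc hR0.le hc
    ⟨(halfPeriod_zero hp).trans_le hℓ.le, h2⟩
  refine ⟨r, ⟨hr.1.lt_of_ne' ?_, hr.2.trans_lt hR⟩, hrℓ⟩
  rintro rfl
  exact hℓ.ne ((halfPeriod_zero hp).symm.trans hrℓ)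

end Length

/-- let `p > 2` and `ℓ* = π/√(p-2)`. With `L₁` the length function
`L₁(z) = (1/√2) ∫_{a(z)}^{b(z)} dt/√(f(t)-f(z))`: if `ℓ > ℓ*` then `L₁` takes the value
`ℓ` at exactly one `z₁ ∈ (0,1)` and exactly one `z₂ ∈ (1,(p/2)^(1/(p-2)))`; if
`0 < ℓ ≤ ℓ*` then `L₁` never takes the value `ℓ` on `(0,(p/2)^(1/(p-2))) \ {1}`. -/
theorem stmt_17 (p : ℝ) (hp : 2 < p) (a b : ℝ → ℝ)
    (hab : ∀ z ∈ Set.Ioo (0 : ℝ) ((p / 2) ^ (1 / (p - 2))) \ {1},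
      a z ∈ Set.Ioo (0 : ℝ) 1 ∧ b z ∈ Set.Ioo (1 : ℝ) ((p / 2) ^ (1 / (p - 2))) ∧
      f p (a z) = f p z ∧ f p (b z) = f p z)
    (L₁ : ℝ → ℝ)
    (hL₁ : ∀ z ∈ Set.Ioo (0 : ℝ) ((p / 2) ^ (1 / (p - 2))) \ {1},
      L₁ z = (1 / Real.sqrt 2) * ∫ t in (a z)..(b z), 1 / Real.sqrt (f p t - f p z))
    (ℓ : ℝ) (hℓ : 0 < ℓ) :
    (Real.pi / Real.sqrt (p - 2) < ℓ →
      (∃! z : ℝ, z ∈ Set.Ioo (0 : ℝ) 1 ∧ L₁ z = ℓ) ∧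
      (∃! z : ℝ, z ∈ Set.Ioo (1 : ℝ) ((p / 2) ^ (1 / (p - 2))) ∧ L₁ z = ℓ)) ∧
    (ℓ ≤ Real.pi / Real.sqrt (p - 2) →
      ∀ z ∈ Set.Ioo (0 : ℝ) ((p / 2) ^ (1 / (p - 2))) \ {1}, L₁ z ≠ ℓ) := by
  have hB := one_lt_wellEnd hp
  have hc : 0 < 1 / √2 := by positivity
  have hL : ∀ z ∈ Ioo 0 (wellEnd p) \ {1},
      L₁ z = 1 / √2 * halfPeriod p √(potential p z) := fun z hz => by
    obtain ⟨ha, hb, hfa, hfb⟩ := hab z hz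
    rw [hL₁ z hz, length_eq_halfPeriod hp hz ha hb hfa hfb]
  have hinj : ∀ z ∈ Ioo 0 (wellEnd p) \ {1}, ∀ w ∈ Ioo 0 (wellEnd p) \ {1}, L₁ z = L₁ w →
      √(potential p z) = √(potential p w) := fun z hz w hw h => by
    rw [hL z hz, hL w hw] at h
    exact (strictMonoOn_halfPeriod hp).injOn ⟨Real.sqrt_nonneg _, sqrt_potential_lt hp hz.1⟩
      ⟨Real.sqrt_nonneg _, sqrt_potential_lt hp hw.1⟩ (mul_left_cancel₀ hc.ne' h)
  have hleft : ∀ z ∈ Ioo (0 : ℝ) 1, z ∈ Ioo 0 (wellEnd p) \ {1} :=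
    fun z hz => ⟨⟨hz.1, hz.2.trans hB⟩, hz.2.ne⟩
  have hright : ∀ z ∈ Ioo 1 (wellEnd p), z ∈ Ioo 0 (wellEnd p) \ {1} :=
    fun z hz => ⟨⟨one_pos.trans hz.1, hz.2⟩, hz.1.ne'⟩
  refine ⟨fun h => ?_, fun h z hz hzℓ => ?_⟩
  · obtain ⟨r, hr, hrℓ⟩ := exists_halfPeriod_eq hp h
    have hr1 : r ∈ Ioo (-wellRadius p) (wellRadius p) := ⟨by linarith [hr.1, hr.2], hr.2⟩
    have hr2 : -r ∈ Ioo (-wellRadius p) (wellRadius p) :=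
      ⟨neg_lt_neg hr.2, by linarith [hr.1, hr.2]⟩
    have hm1 : wellInverse p (-r) ∈ Ioo (0 : ℝ) 1 :=
      ⟨(wellInverse_mem hp hr2).1, wellInverse_lt_one hp (neg_lt_zero.2 hr.1) hr2.1⟩
    have hm2 : wellInverse p r ∈ Ioo 1 (wellEnd p) :=
      ⟨wellInverse_gt_one hp hr.1 hr.2, (wellInverse_mem hp hr1).2⟩
    have hv1 : L₁ (wellInverse p (-r)) = ℓ := by
      rw [hL _ (hleft _ hm1), potential_wellInverse hp hr2, neg_sq, Real.sqrt_sq hr.1.le, hrℓ]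
    have hv2 : L₁ (wellInverse p r) = ℓ := by
      rw [hL _ (hright _ hm2), potential_wellInverse hp hr1, Real.sqrt_sq hr.1.le, hrℓ]
    refine ⟨⟨_, ⟨hm1, hv1⟩, fun w hw => ?_⟩, ⟨_, ⟨hm2, hv2⟩, fun w hw => ?_⟩⟩
    · rw [← wellInverse_neg_sqrt_potential hp hw.1,
        hinj w (hleft w hw.1) _ (hleft _ hm1) (hw.2.trans hv1.symm),
        wellInverse_neg_sqrt_potential hp hm1]
    · rw [← wellInverse_sqrt_potential hp hw.1,
        hinj w (hright w hw.1) _ (hright _ hm2) (hw.2.trans hv2.symm),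
        wellInverse_sqrt_potential hp hm2]
  · rw [hL z hz] at hzℓ
    have hlt := strictMonoOn_halfPeriod hp ⟨le_rfl, wellRadius_pos hp⟩
      ⟨Real.sqrt_nonneg _, sqrt_potential_lt hp hz.1⟩ (sqrt_potential_pos hp hz.1.1 hz.2)
    have := mul_lt_mul_of_pos_left hlt hc
    rw [halfPeriod_zero hp] at this
    linarith
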